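/- Let M be a finite-dimensional ℂ[∂₁,…,∂ₙ]-module and let 𝒪 denote the ℂ[∂]-module of entire functions on ℂⁿ (with ∂_i acting as ∂/∂y_i), and Ô the module of formal power series. Then the restriction maps Hom_{ℂ[∂]}(M, ⊕_{λ∈ℂⁿ} ℂ[y]e^{⟨λ,y⟩}) → Hom_{ℂ[∂]}(M, 𝒪) → Hom_{ℂ[∂]}(M, Ô) are bijections, and all three spaces have dimension dim_ℂ M. -/

import Mathlib

open MvPolynomial

/-- Formal partial derivative `∂/∂y_i` on multivariate formal power series. -/
noncomputable def mvD (n : ℕ) (i : Fin n) :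
    MvPowerSeries (Fin n) ℂ →ₗ[ℂ] MvPowerSeries (Fin n) ℂ where
  toFun φ := fun d => ((d i : ℂ) + 1) * φ (d + Finsupp.single i 1)
  map_add' φ ψ := by
    funext d
    show ((d i : ℂ) + 1) * (φ (d + Finsupp.single i 1) + ψ (d + Finsupp.single i 1)) =
      ((d i : ℂ) + 1) * φ (d + Finsupp.single i 1) +
        ((d i : ℂ) + 1) * ψ (d + Finsupp.single i 1)
    ring
  map_smul' c φ := by
    funext d
    show ((d i : ℂ) + 1) * (c * φ _) = c * (((d i : ℂ) + 1) * φ _)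
    ring

/-- The exponential power series `e^{⟨λ,y⟩} = Σ_d Π_i λ_i^{d_i}/d_i!`. -/
noncomputable def expS (n : ℕ) (lam : Fin n → ℂ) : MvPowerSeries (Fin n) ℂ :=
  fun d => ∏ i, lam i ^ d i / (Nat.factorial (d i) : ℂ)

/-- The space of exponential-polynomial power series
    `⊕_{λ∈ℂⁿ} ℂ[y] e^{⟨λ,y⟩}` inside `ℂ[[y]]`. -/
noncomputable def expPolySpan (n : ℕ) : Submodule ℂ (MvPowerSeries (Fin n) ℂ) :=
  Submodule.span ℂ {φ | ∃ (lam : Fin n → ℂ) (p : MvPolynomial (Fin n) ℂ),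
    φ = (p : MvPowerSeries (Fin n) ℂ) * expS n lam}

/-- `ℂ[∂]`-module homomorphisms `M → ℂ[[y]]` (with `∂_i` acting on `ℂ[[y]]` as
    `∂/∂y_i`): `ℂ`-linear maps intertwining the generators. -/
noncomputable def intertwPS (n : ℕ) (M : Type*) [AddCommGroup M]
    [Module (MvPolynomial (Fin n) ℂ) M] [Module ℂ M]
    [IsScalarTower ℂ (MvPolynomial (Fin n) ℂ) M] :
    Submodule ℂ (M →ₗ[ℂ] MvPowerSeries (Fin n) ℂ) where
  carrier := {f | ∀ (i : Fin n) (x : M),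
    f ((X i : MvPolynomial (Fin n) ℂ) • x) = mvD n i (f x)}
  add_mem' := by intro f g hf hg i x; simp [hf i x, hg i x]
  zero_mem' := by intro i x; simp
  smul_mem' := by intro c f hf i x; simp [hf i x]

lemma mvD_eq (n : ℕ) (i : Fin n) (φ : MvPowerSeries (Fin n) ℂ) :
    mvD n i φ = MvPowerSeries.pderiv ℂ i φ := by
  ext d
  rw [MvPowerSeries.coeff_pderiv, mul_comm]
  rfl

lemma mvD_coeff (n : ℕ) (i : Fin n) (φ : MvPowerSeries (Fin n) ℂ) (d : Fin n →₀ ℕ) :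
    (mvD n i φ) d = ((d i : ℂ) + 1) * φ (d + Finsupp.single i 1) := rfl

lemma mvD_mul (n : ℕ) (i : Fin n) (φ ψ : MvPowerSeries (Fin n) ℂ) :
    mvD n i (φ * ψ) = φ * mvD n i ψ + mvD n i φ * ψ := by
  simp only [mvD_eq, Derivation.leibniz, smul_eq_mul]
  ring

lemma fac_prod (n : ℕ) (i : Fin n) (d : Fin n →₀ ℕ) :
    (∏ j, (((d + Finsupp.single i 1 : Fin n →₀ ℕ) j).factorial : ℂ)) =
      ((d i : ℂ) + 1) * ∏ j, ((d j).factorial : ℂ) := by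
  classical
  rw [← Finset.mul_prod_erase _ _ (Finset.mem_univ i),
    ← Finset.mul_prod_erase (a := i) _ (fun j => ((d j).factorial : ℂ)) (Finset.mem_univ i)]
  have : ∀ j ∈ Finset.univ.erase i, (((d + Finsupp.single i 1 : Fin n →₀ ℕ) j).factorial : ℂ)
      = ((d j).factorial : ℂ) := by
    intro j hj
    rw [Finsupp.add_apply, Finsupp.single_eq_of_ne (Finset.ne_of_mem_erase hj), add_zero]
  rw [Finset.prod_congr rfl this]
  simp [Nat.factorial_succ, mul_assoc]

lemma pow_prod (n : ℕ) (i : Fin n) (d : Fin n →₀ ℕ) (lam : Fin n → ℂ) :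
    (∏ j, lam j ^ ((d + Finsupp.single i 1 : Fin n →₀ ℕ) j)) = lam i * ∏ j, lam j ^ d j := by
  classical
  simp only [Finsupp.add_apply, pow_add, Finset.prod_mul_distrib]
  rw [mul_comm]
  congr 1
  rw [Finset.prod_eq_single i]
  · simp
  · intro j _ hj
    simp [Finsupp.single_eq_of_ne hj]
  · simp

lemma mvD_expS (n : ℕ) (i : Fin n) (lam : Fin n → ℂ) :
    mvD n i (expS n lam) = lam i • expS n lam := by
  funext d
  rw [mvD_coeff]
  change _ = lam i * expS n lam d
  unfold expS
  rw [Finset.prod_div_distrib, Finset.prod_div_distrib, fac_prod, pow_prod]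
  have h1 : ((d i : ℂ) + 1) ≠ 0 := Nat.cast_add_one_ne_zero _
  have h2 : (∏ j, ((d j).factorial : ℂ)) ≠ 0 :=
    Finset.prod_ne_zero_iff.2 fun j _ => by exact_mod_cast Nat.factorial_ne_zero _
  field_simp

lemma expS_mul_neg (n : ℕ) (lam : Fin n → ℂ) : expS n (-lam) * expS n lam = 1 := by
  apply MvPowerSeries.pderiv.ext (R := ℂ)
  · intro i
    rw [← mvD_eq, mvD_mul, mvD_expS, mvD_expS, MvPowerSeries.pderiv_one]
    simp
  · rw [map_mul, map_one]
    have : ∀ l : Fin n → ℂ, MvPowerSeries.constantCoeff (expS n l) = 1 := by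
      intro l
      change expS n l 0 = 1
      simp [expS]
    simp [this]

lemma conjExp_pow (n : ℕ) (i : Fin n) (lam : Fin n → ℂ) (k : ℕ) (φ : MvPowerSeries (Fin n) ℂ) :
    (mvD n i ^ k) (φ * expS n (-lam)) =
      (((mvD n i - lam i • (1 : Module.End ℂ (MvPowerSeries (Fin n) ℂ))) ^ k) φ)
        * expS n (-lam) := by
  induction k generalizing φ with
  | zero => simp
  | succ k ih =>
    rw [pow_succ, pow_succ, Module.End.mul_apply, Module.End.mul_apply, ← ih, mvD_mul, mvD_expS]
    congr 1
    simp only [Pi.neg_apply, neg_smul, mul_neg, LinearMap.sub_apply, LinearMap.smul_apply,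
      Module.End.one_apply, sub_mul, Algebra.smul_mul_assoc, Algebra.mul_smul_comm]
    ring

lemma coeff_zero_of_pow (n : ℕ) (i : Fin n) (k : ℕ) (φ : MvPowerSeries (Fin n) ℂ)
    (h : (mvD n i ^ k) φ = 0) (d : Fin n →₀ ℕ) (hd : k ≤ d i) : φ d = 0 := by
  classical
  induction k generalizing φ d with
  | zero =>
    have : φ = 0 := by simpa using h
    rw [this]; rfl
  | succ k ih =>
    rw [pow_succ, Module.End.mul_apply] at h
    have hle : Finsupp.single i 1 ≤ d := by
      rw [Finsupp.single_le_iff]; omega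
    have := ih _ h (d - Finsupp.single i 1) (by simp; omega)
    rw [mvD_coeff, tsub_add_cancel_of_le hle] at this
    refine (mul_eq_zero.1 this).resolve_left ?_
    exact Nat.cast_add_one_ne_zero _

lemma isPoly (n : ℕ) (φ : MvPowerSeries (Fin n) ℂ)
    (h : ∀ i, ∃ k, (mvD n i ^ k) φ = 0) :
    ∃ p : MvPolynomial (Fin n) ℂ, (p : MvPowerSeries (Fin n) ℂ) = φ := by
  classical
  choose k hk using h
  refine ⟨MvPowerSeries.trunc' ℂ (Finsupp.equivFunOnFinite.symm k) φ, ?_⟩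
  ext d
  rw [MvPolynomial.coeff_coe, MvPowerSeries.coeff_trunc']
  split_ifs with hd
  · rfl
  · have : ∃ i, k i < d i := by
      by_contra! hc
      exact hd fun i => by simpa using hc i
    obtain ⟨i, hi⟩ := this
    exact (coeff_zero_of_pow n i (k i) φ (hk i) d hi.le).symm

lemma mem_exp (n : ℕ) (φ : MvPowerSeries (Fin n) ℂ) (lam : Fin n → ℂ)
    (h : ∀ i, ∃ k : ℕ,
      ((mvD n i - lam i • (1 : Module.End ℂ (MvPowerSeries (Fin n) ℂ))) ^ k) φ = 0) :
    φ ∈ expPolySpan n := by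
  obtain ⟨p, hp⟩ := isPoly n (φ * expS n (-lam)) fun i => by
    obtain ⟨k, hk⟩ := h i
    exact ⟨k, by rw [conjExp_pow, hk, zero_mul]⟩
  refine Submodule.subset_span ⟨lam, p, ?_⟩
  rw [hp, mul_assoc, expS_mul_neg, mul_one]

section
variable (n : ℕ) (M : Type*) [AddCommGroup M]
    [Module (MvPolynomial (Fin n) ℂ) M] [Module ℂ M]
    [IsScalarTower ℂ (MvPolynomial (Fin n) ℂ) M]

noncomputable def actX (i : Fin n) : Module.End ℂ M :=
  Algebra.lsmul ℂ ℂ M (X i : MvPolynomial (Fin n) ℂ)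

lemma part1 [FiniteDimensional ℂ M] (f : M →ₗ[ℂ] MvPowerSeries (Fin n) ℂ)
    (hf : f ∈ intertwPS n M) (x : M) : f x ∈ expPolySpan n := by
  have htop := Module.End.iSup_iInf_maxGenEigenspace_eq_top_of_iSup_maxGenEigenspace_eq_top_of_commute
    (actX n M) (fun i j _ => by
      change _ * _ = _ * _
      simp only [actX, ← map_mul, mul_comm])
    (fun i => Module.End.iSup_maxGenEigenspace_eq_top _)
  have hx : x ∈ (⊤ : Submodule ℂ M) := trivial
  rw [← htop] at hx
  suffices hle : (⨆ χ : Fin n → ℂ, ⨅ i, (actX n M i).maxGenEigenspace (χ i)) ≤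
      (expPolySpan n).comap f from hle hx
  refine iSup_le fun lam y hy => ?_
  rw [Module.End.mem_iInf_maxGenEigenspace_iff] at hy
  refine mem_exp n (f y) lam fun i => ?_
  obtain ⟨k, hk⟩ := hy i
  refine ⟨k, ?_⟩
  rw [← map_zero f, ← hk]
  clear hk hy hx
  induction k generalizing y with
  | zero => simp
  | succ k ih =>
    rw [pow_succ, pow_succ, Module.End.mul_apply, Module.End.mul_apply, ← ih]
    congr 1
    simp only [LinearMap.sub_apply, LinearMap.smul_apply, Module.End.one_apply, map_sub, map_smul]
    rw [← hf i y]
    rfl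

noncomputable def ev0 : intertwPS n M →ₗ[ℂ] Module.Dual ℂ M where
  toFun f := (MvPowerSeries.coeff (0 : Fin n →₀ ℕ)) ∘ₗ f.1
  map_add' f g := by ext x; simp
  map_smul' c f := by ext x; simp

lemma ev0_inj : Function.Injective (ev0 n M) := by
  classical
  rw [injective_iff_map_eq_zero]
  rintro ⟨f, hf⟩ h
  have h0 : ∀ x, f x 0 = 0 := fun x => LinearMap.congr_fun h x
  have key : ∀ (m : ℕ) (d : Fin n →₀ ℕ), d.degree = m → ∀ x, f x d = 0 := by
    intro m
    induction m with
    | zero =>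
      intro d hd x
      rw [Finsupp.degree_eq_zero_iff] at hd
      rw [hd, h0]
    | succ m ih =>
      intro d hd x
      have hne : d ≠ 0 := by rintro rfl; simp at hd
      obtain ⟨i, hi⟩ := Finsupp.ne_iff.1 hne
      have hle : Finsupp.single i 1 ≤ d := by
        rw [Finsupp.single_le_iff]; exact Nat.one_le_iff_ne_zero.2 hi
      obtain ⟨e, rfl⟩ := exists_add_of_le hle
      rw [map_add, Finsupp.degree_single] at hd
      have h1 := ih e (by omega) ((X i : MvPolynomial (Fin n) ℂ) • x)
      rw [hf i x, mvD_coeff, add_comm e] at h1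
      refine (mul_eq_zero.1 h1).resolve_left ?_
      exact Nat.cast_add_one_ne_zero _
  apply Subtype.ext
  ext x d
  exact key _ d rfl x

lemma ev0_surj : Function.Surjective (ev0 n M) := by
  classical
  intro l
  let f : M →ₗ[ℂ] MvPowerSeries (Fin n) ℂ :=
    { toFun := fun x d => l ((monomial d (∏ j, ((d j).factorial : ℂ))⁻¹ :
        MvPolynomial (Fin n) ℂ) • x)
      map_add' := fun x y => by funext d; rw [smul_add, map_add]; rfl
      map_smul' := fun c x => by
        funext d
        rw [smul_comm, map_smul]; rfl }
  have hfd : ∀ x d, f x d = l ((monomial d (∏ j, ((d j).factorial : ℂ))⁻¹ :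
        MvPolynomial (Fin n) ℂ) • x) := fun x d => rfl
  refine ⟨⟨f, ?_⟩, ?_⟩
  · intro i x
    funext d
    rw [mvD_coeff, hfd, hfd, fac_prod, smul_smul,
      ← smul_eq_mul (a := (d i : ℂ) + 1) (b := l _), ← map_smul, ← smul_assoc]
    congr 2
    have h1 : ((d i : ℂ) + 1) ≠ 0 := Nat.cast_add_one_ne_zero _
    rw [X, monomial_mul, smul_monomial, mul_one, smul_eq_mul, mul_inv, mul_inv_cancel_left₀ h1]
  · ext x
    change f x 0 = l x
    rw [hfd]
    have : (monomial (0 : Fin n →₀ ℕ) (∏ j, (((0 : Fin n →₀ ℕ) j).factorial : ℂ))⁻¹ :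
        MvPolynomial (Fin n) ℂ) = 1 := by simp
    rw [this, one_smul]

end

theorem stmt_4 (n : ℕ) (M : Type*) [AddCommGroup M]
    [Module (MvPolynomial (Fin n) ℂ) M] [Module ℂ M]
    [IsScalarTower ℂ (MvPolynomial (Fin n) ℂ) M] [FiniteDimensional ℂ M] :
    (∀ f : M →ₗ[ℂ] MvPowerSeries (Fin n) ℂ, f ∈ intertwPS n M →
      ∀ x : M, f x ∈ expPolySpan n) ∧
    Module.finrank ℂ (intertwPS n M) = Module.finrank ℂ M := by
  refine ⟨fun f hf x => part1 n M f hf x, ?_⟩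
  rw [(LinearEquiv.ofBijective (ev0 n M) ⟨ev0_inj n M, ev0_surj n M⟩).finrank_eq]
  exact Subspace.dual_finrank_eq
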